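/- Every satisfiable sentence ψ of the (syntactic) clique guarded fragment CGF of first-order logic over a relational vocabulary has a countable model of tree width at most width(ψ) − 1. In particular, CGF (and hence the guarded fragment GF) has the generalized tree model property. -/

import Mathlib

namespace Stmt19

/-- a relational vocabulary: a type of relation symbols with arities -/
structure Vocab : Type 1 where
  rel : Type
  ar : rel → ℕ

/-- first-order formulas over the relational vocabulary `σ`, with variables from `ℕ` -/
inductive Fml (σ : Vocab) : Type
  | tru : Fml σ
  | atom : (r : σ.rel) → (Fin (σ.ar r) → ℕ) → Fml σ
  | eq : ℕ → ℕ → Fml σ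
  | not : Fml σ → Fml σ
  | and : Fml σ → Fml σ → Fml σ
  | or : Fml σ → Fml σ → Fml σ
  | imp : Fml σ → Fml σ → Fml σ
  | all : ℕ → Fml σ → Fml σ
  | ex : ℕ → Fml σ → Fml σ

/-- a structure for the vocabulary `σ` -/
structure Struct (σ : Vocab) where
  Δ : Type
  nonempty : Nonempty Δ
  interp : (r : σ.rel) → Set (Fin (σ.ar r) → Δ)

variable {σ : Vocab}

/-- Tarski semantics -/
def Struct.Realize (M : Struct σ) : Fml σ → (ℕ → M.Δ) → Prop
  | .tru, _ => True
  | .atom r args, ρ => (fun i => ρ (args i)) ∈ M.interp r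
  | .eq v w, ρ => ρ v = ρ w
  | .not φ, ρ => ¬M.Realize φ ρ
  | .and φ ψ, ρ => M.Realize φ ρ ∧ M.Realize ψ ρ
  | .or φ ψ, ρ => M.Realize φ ρ ∨ M.Realize ψ ρ
  | .imp φ ψ, ρ => M.Realize φ ρ → M.Realize ψ ρ
  | .all v φ, ρ => ∀ a, M.Realize φ (Function.update ρ v a)
  | .ex v φ, ρ => ∃ a, M.Realize φ (Function.update ρ v a)

/-- free variables of a formula -/
def freeVars : Fml σ → Finset ℕ
  | .tru => ∅
  | .atom _ args => Finset.univ.image args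
  | .eq v w => {v, w}
  | .not φ => freeVars φ
  | .and φ ψ => freeVars φ ∪ freeVars ψ
  | .or φ ψ => freeVars φ ∪ freeVars ψ
  | .imp φ ψ => freeVars φ ∪ freeVars ψ
  | .all v φ => freeVars φ \ {v}
  | .ex v φ => freeVars φ \ {v}

/-- `width(ψ) = max{|free(φ)| : φ a subformula of ψ}` -/
def width : Fml σ → ℕ
  | .tru => 0
  | .atom r args => (freeVars (Fml.atom r args)).card
  | .eq v w => (freeVars (σ := σ) (Fml.eq v w)).card
  | .not φ => width φ
  | .and φ ψ => max (max (width φ) (width ψ)) (freeVars (Fml.and φ ψ)).card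
  | .or φ ψ => max (max (width φ) (width ψ)) (freeVars (Fml.or φ ψ)).card
  | .imp φ ψ => max (max (width φ) (width ψ)) (freeVars (Fml.imp φ ψ)).card
  | .all _ φ => width φ
  | .ex _ φ => width φ

/-- a relational atom -/
def FAtom (σ : Vocab) : Type := Σ r : σ.rel, Fin (σ.ar r) → ℕ

/-- the conjunction of a list of atoms -/
def conjAtoms (α : List (FAtom σ)) : Fml σ :=
  (α.map fun a => Fml.atom a.1 a.2).foldr Fml.and Fml.tru

def alls (l : List ℕ) (φ : Fml σ) : Fml σ := l.foldr Fml.all φ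

def exs (l : List ℕ) (φ : Fml σ) : Fml σ := l.foldr Fml.ex φ

/-- `α` is a clique-formula for the variable set `xy`, with additional variables
`zs` -/
def CliqueFormula (xy : Set ℕ) (zs : List ℕ) (α : List (FAtom σ)) : Prop :=
  (∀ v ∈ xy, ∀ w ∈ xy, v ≠ w → ∃ a ∈ α, (∃ i, a.2 i = v) ∧ (∃ j, a.2 j = w)) ∧
  (∀ a ∈ α, ∃ i, a.2 i ∈ xy) ∧
  (∀ v ∈ zs, (α.map fun a => (Finset.univ.filter fun i => a.2 i = v).card).sum = 1) ∧
  (∀ a ∈ α, ∀ i, a.2 i ∈ xy ∨ a.2 i ∈ zs)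

/-- the (syntactic) clique guarded fragment CGF: relational atoms and equalities,
closed under Boolean connectives and under clique-guarded quantification -/
inductive InCGF : Fml σ → Prop
  | atom (r : σ.rel) (args : Fin (σ.ar r) → ℕ) : InCGF (.atom r args)
  | eq (v w : ℕ) : InCGF (.eq v w)
  | not {φ : Fml σ} : InCGF φ → InCGF (.not φ)
  | and {φ ψ : Fml σ} : InCGF φ → InCGF ψ → InCGF (.and φ ψ)
  | or {φ ψ : Fml σ} : InCGF φ → InCGF ψ → InCGF (.or φ ψ)
  | imp {φ ψ : Fml σ} : InCGF φ → InCGF ψ → InCGF (.imp φ ψ)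
  | exG (xs ys zs : List ℕ) (α : List (FAtom σ)) (φ : Fml σ) :
      (xs ++ ys ++ zs).Nodup →
      CliqueFormula {v | v ∈ xs ∨ v ∈ ys} zs α →
      InCGF φ → freeVars φ ⊆ xs.toFinset ∪ ys.toFinset →
      InCGF (exs (ys ++ zs) (.and (conjAtoms α) φ))
  | allG (xs ys zs : List ℕ) (α : List (FAtom σ)) (φ : Fml σ) :
      (xs ++ ys ++ zs).Nodup →
      CliqueFormula {v | v ∈ xs ∨ v ∈ ys} zs α →
      InCGF φ → freeVars φ ⊆ xs.toFinset ∪ ys.toFinset →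
      InCGF (alls (ys ++ zs) (.imp (conjAtoms α) φ))

/-- the structure `M` has tree width at most `k`: there is a tree `T` and an
assignment `f` of bags of size at most `k+1` to its vertices such that every tuple of
every relation is contained in some bag and, for every element `a`, the vertices whose
bag contains `a` induce a subtree of `T` -/
def TreeWidthLE (M : Struct σ) (k : ℕ) : Prop :=
  ∃ (W : Type) (T : SimpleGraph W) (f : W → Set M.Δ),
    T.IsTree ∧
    (∀ v : W, (f v).encard ≤ ((k : ℕ∞) + 1)) ∧
    (∀ (r : σ.rel) (t : Fin (σ.ar r) → M.Δ), t ∈ M.interp r → ∃ v : W, Set.range t ⊆ f v) ∧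
    (∀ a : M.Δ, ((T.induce {v | a ∈ f v}).Connected))

theorem realize_congr (M : Struct σ) (φ : Fml σ) : ∀ (ρ τ : ℕ → M.Δ),
    (∀ v ∈ freeVars φ, ρ v = τ v) → (M.Realize φ ρ ↔ M.Realize φ τ) := by
  induction φ with
  | tru => intro ρ τ h; simp [Struct.Realize]
  | atom r args =>
    intro ρ τ h
    have : (fun i => ρ (args i)) = fun i => τ (args i) := by
      funext i; exact h _ (by simp [freeVars])
    simp only [Struct.Realize, this]
  | eq v w =>
    intro ρ τ h
    simp only [Struct.Realize]
    rw [h v (by simp [freeVars]), h w (by simp [freeVars])]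
  | not φ ih => intro ρ τ h; simp only [Struct.Realize]; rw [ih ρ τ h]
  | and φ ψ ih1 ih2 =>
    intro ρ τ h; simp only [Struct.Realize]
    rw [ih1 ρ τ (fun v hv => h v (by simp [freeVars, hv])),
      ih2 ρ τ (fun v hv => h v (by simp [freeVars, hv]))]
  | or φ ψ ih1 ih2 =>
    intro ρ τ h; simp only [Struct.Realize]
    rw [ih1 ρ τ (fun v hv => h v (by simp [freeVars, hv])),
      ih2 ρ τ (fun v hv => h v (by simp [freeVars, hv]))]
  | imp φ ψ ih1 ih2 =>
    intro ρ τ h; simp only [Struct.Realize]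
    rw [ih1 ρ τ (fun v hv => h v (by simp [freeVars, hv])),
      ih2 ρ τ (fun v hv => h v (by simp [freeVars, hv]))]
  | all v φ ih =>
    intro ρ τ h; simp only [Struct.Realize]
    refine forall_congr' fun a => ih _ _ fun w hw => ?_
    by_cases hwv : w = v
    · subst hwv; simp
    · simp [hwv, h w (by simp [freeVars, hw, hwv])]
  | ex v φ ih =>
    intro ρ τ h; simp only [Struct.Realize]
    refine exists_congr fun a => ih _ _ fun w hw => ?_
    by_cases hwv : w = v
    · subst hwv; simp
    · simp [hwv, h w (by simp [freeVars, hw, hwv])]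

/-- formulas whose witnesses are needed -/
def subs : Fml σ → Set (Fml σ)
  | .tru => ∅
  | .atom _ _ => ∅
  | .eq _ _ => ∅
  | .not φ => subs φ
  | .and φ ψ => subs φ ∪ subs ψ
  | .or φ ψ => subs φ ∪ subs ψ
  | .imp φ ψ => subs φ ∪ subs ψ
  | .all _ φ => insert (.not φ) (subs φ)
  | .ex _ φ => insert φ (subs φ)

theorem subs_countable (φ : Fml σ) : (subs φ).Countable := by
  induction φ <;> simp_all [subs]

/-- Skolem language -/
def skLang (Φ : Set (Fml σ)) : FirstOrder.Language where
  Functions := fun _ => Φ × ℕ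
  Relations := fun _ => Empty

open Classical in
/-- Skolem structure -/
noncomputable def skStr (M : Struct σ) (Φ : Set (Fml σ)) (d : M.Δ) :
    (skLang Φ).Structure M.Δ where
  funMap := fun {n} f x =>
    if h : ∃ a, M.Realize f.1.1
      (Function.update (fun i => if hi : i < n then x ⟨i, hi⟩ else d) f.2 a)
    then h.choose else d
  RelMap := fun r => r.elim

theorem exists_closed (M : Struct σ) (Φ : Set (Fml σ)) (hΦ : Φ.Countable) :
    ∃ S : Set M.Δ, S.Countable ∧ S.Nonempty ∧ ∀ φ ∈ Φ, ∀ v (ρ : ℕ → M.Δ), (∀ i, ρ i ∈ S) →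
      (∃ a, M.Realize φ (Function.update ρ v a)) →
      ∃ a ∈ S, M.Realize φ (Function.update ρ v a) := by
  classical
  obtain ⟨d⟩ := M.nonempty
  letI := skStr M Φ d
  have : Countable Φ := hΦ
  haveI : Countable (Σ l, (skLang Φ).Functions l) :=
    inferInstanceAs (Countable (Σ _ : ℕ, Φ × ℕ))
  let S := FirstOrder.Language.Substructure.closure (skLang Φ) ({d} : Set M.Δ)
  have hS : Countable S := Set.Countable.substructure_closure _ (Set.countable_singleton d)
  refine ⟨S, hS, ⟨d, FirstOrder.Language.Substructure.subset_closure rfl⟩, ?_⟩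
  intro φ hφ v ρ hρ hex
  let n := (freeVars φ).sup id + 1
  have hn : ∀ i ∈ freeVars φ, i < n := fun i hi =>
    Nat.lt_succ_of_le (Finset.le_sup (f := id) hi)
  let F : (skLang Φ).Functions n := (⟨⟨φ, hφ⟩, v⟩ : Φ × ℕ)
  have hc : ∀ a, M.Realize φ (Function.update ρ v a) ↔
      M.Realize φ (Function.update (fun i => if hi : i < n then ρ i else d) v a) := by
    intro a
    refine realize_congr M φ _ _ fun i hi => ?_
    simp [Function.update_apply, hn i hi]
  have hex' := hex
  simp only [hc] at hex'
  have hmem := S.fun_mem F (fun i => ρ i) (fun i => hρ i)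
  refine ⟨_, hmem, ?_⟩
  rw [hc]
  have : (FirstOrder.Language.Structure.funMap F fun i : Fin n => ρ i) = hex'.choose :=
    dif_pos hex'
  rw [this]
  exact hex'.choose_spec

/-- restriction to a subset -/
abbrev restr (M : Struct σ) (S : Set M.Δ) (h : S.Nonempty) : Struct σ where
  Δ := S
  nonempty := h.to_subtype
  interp := fun r => {t | (fun i => (t i : M.Δ)) ∈ M.interp r}

theorem realize_restr (M : Struct σ) (S : Set M.Δ) (h : S.Nonempty) (Φ : Set (Fml σ))
    (hS : ∀ φ ∈ Φ, ∀ v (ρ : ℕ → M.Δ), (∀ i, ρ i ∈ S) →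
      (∃ a, M.Realize φ (Function.update ρ v a)) →
      ∃ a ∈ S, M.Realize φ (Function.update ρ v a)) (φ : Fml σ) :
    subs φ ⊆ Φ → ∀ ρ : ℕ → S,
      ((restr M S h).Realize φ ρ ↔ M.Realize φ (fun i => (ρ i : M.Δ))) := by
  have upd : ∀ (ρ : ℕ → S) (v : ℕ) (a : S),
      (fun i => ((Function.update ρ v a i : S) : M.Δ)) =
        Function.update (fun i => (ρ i : M.Δ)) v a := by
    intro ρ v a; funext i
    by_cases hi : i = v
    · subst hi; simp
    · simp [hi]
  induction φ with
  | tru => intro _ ρ; simp [Struct.Realize]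
  | atom r args => intro _ ρ; exact Iff.rfl
  | eq v w => intro _ ρ; exact Subtype.ext_iff
  | not φ ih => intro hs ρ; simp only [Struct.Realize]; rw [ih hs ρ]
  | and φ ψ ih1 ih2 =>
    intro hs ρ; simp only [Struct.Realize]
    rw [ih1 (fun x hx => hs (Or.inl hx)) ρ, ih2 (fun x hx => hs (Or.inr hx)) ρ]
  | or φ ψ ih1 ih2 =>
    intro hs ρ; simp only [Struct.Realize]
    rw [ih1 (fun x hx => hs (Or.inl hx)) ρ, ih2 (fun x hx => hs (Or.inr hx)) ρ]
  | imp φ ψ ih1 ih2 =>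
    intro hs ρ; simp only [Struct.Realize]
    rw [ih1 (fun x hx => hs (Or.inl hx)) ρ, ih2 (fun x hx => hs (Or.inr hx)) ρ]
  | all v φ ih =>
    intro hs ρ; simp only [Struct.Realize]
    have ih := ih (fun x hx => hs (Or.inr hx))
    constructor
    · intro H
      by_contra hcon
      push Not at hcon
      obtain ⟨a, ha, hr⟩ := hS _ (hs (Or.inl rfl)) v (fun i => (ρ i : M.Δ))
        (fun i => (ρ i).2) hcon
      have := (ih _).1 (H ⟨a, ha⟩)
      rw [upd] at this
      exact hr this
    · intro H a
      refine (ih _).2 ?_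
      rw [upd]; exact H _
  | ex v φ ih =>
    intro hs ρ; simp only [Struct.Realize]
    have ih := ih (fun x hx => hs (Or.inr hx))
    constructor
    · rintro ⟨a, ha⟩
      refine ⟨(a : S), ?_⟩
      have := (ih _).1 ha
      rw [upd] at this
      exact this
    · intro H
      obtain ⟨a, ha, hr⟩ := hS _ (hs (Or.inl rfl)) v (fun i => (ρ i : M.Δ))
        (fun i => (ρ i).2) H
      refine ⟨⟨a, ha⟩, (ih _).2 ?_⟩
      rw [upd]; exact hr

theorem exists_countable_model (ψ : Fml σ) (hsentence : freeVars ψ = ∅)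
    (hsat : ∃ (M : Struct σ) (ρ : ℕ → M.Δ), M.Realize ψ ρ) :
    ∃ (M : Struct σ), Countable M.Δ ∧ ∃ ρ : ℕ → M.Δ, M.Realize ψ ρ := by
  obtain ⟨M, ρ, hρ⟩ := hsat
  obtain ⟨S, hc, hne, hS⟩ := exists_closed M (subs ψ) (subs_countable ψ)
  refine ⟨restr M S hne, hc, fun _ => ⟨hne.some, hne.some_mem⟩, ?_⟩
  refine (realize_restr M S hne _ hS ψ subset_rfl _).2 ?_
  exact (realize_congr M ψ _ ρ (by simp [hsentence])).2 hρ

/-! Quantifier blocks. -/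

theorem realize_exs (M : Struct σ) (φ : Fml σ) (l : List ℕ) : ∀ ρ : ℕ → M.Δ,
    (M.Realize (exs l φ) ρ ↔ ∃ τ : ℕ → M.Δ, (∀ v, v ∉ l → τ v = ρ v) ∧ M.Realize φ τ) := by
  induction l with
  | nil =>
    intro ρ
    constructor
    · intro h; exact ⟨ρ, fun _ _ => rfl, h⟩
    · rintro ⟨τ, h1, h2⟩
      have : τ = ρ := funext fun v => h1 v (by simp)
      subst this; exact h2
  | cons x l ih =>
    intro ρ
    have : M.Realize (exs (x :: l) φ) ρ ↔ ∃ a, M.Realize (exs l φ) (Function.update ρ x a) :=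
      Iff.rfl
    rw [this]
    constructor
    · rintro ⟨a, ha⟩
      obtain ⟨τ, h1, h2⟩ := (ih _).1 ha
      refine ⟨τ, fun v hv => ?_, h2⟩
      simp only [List.mem_cons, not_or] at hv
      rw [h1 v hv.2]; simp [hv.1]
    · rintro ⟨τ, h1, h2⟩
      refine ⟨τ x, (ih _).2 ⟨τ, fun v hv => ?_, h2⟩⟩
      by_cases hvx : v = x
      · subst hvx; simp
      · simp [hvx, h1 v (by simp [hvx, hv])]

theorem realize_alls (M : Struct σ) (φ : Fml σ) (l : List ℕ) : ∀ ρ : ℕ → M.Δ,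
    (M.Realize (alls l φ) ρ ↔ ∀ τ : ℕ → M.Δ, (∀ v, v ∉ l → τ v = ρ v) → M.Realize φ τ) := by
  intro ρ
  have key : ∀ ρ : ℕ → M.Δ, M.Realize (alls l φ) ρ ↔ ¬ M.Realize (exs l (.not φ)) ρ := by
    induction l with
    | nil => intro ρ; exact not_not.symm
    | cons x l ih =>
      intro ρ
      change (∀ a, M.Realize (alls l φ) (Function.update ρ x a)) ↔
        ¬ ∃ a, M.Realize (exs l (.not φ)) (Function.update ρ x a)
      simp only [ih, not_exists]
  rw [key, realize_exs]
  simp only [Struct.Realize]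
  push Not
  rfl

theorem freeVars_exs (φ : Fml σ) (l : List ℕ) (v : ℕ) :
    v ∈ freeVars (exs l φ) ↔ v ∈ freeVars φ ∧ v ∉ l := by
  induction l with
  | nil => simp [exs]
  | cons x l ih =>
    have : freeVars (exs (x :: l) φ) = freeVars (exs l φ) \ {x} := rfl
    rw [this]; simp [ih]; tauto

theorem freeVars_alls (φ : Fml σ) (l : List ℕ) (v : ℕ) :
    v ∈ freeVars (alls l φ) ↔ v ∈ freeVars φ ∧ v ∉ l := by
  induction l with
  | nil => simp [alls]
  | cons x l ih =>
    have : freeVars (alls (x :: l) φ) = freeVars (alls l φ) \ {x} := rfl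
    rw [this]; simp [ih]; tauto

theorem width_exs (φ : Fml σ) (l : List ℕ) : width (exs l φ) = width φ := by
  induction l with
  | nil => rfl
  | cons x l ih => exact ih

theorem width_alls (φ : Fml σ) (l : List ℕ) : width (alls l φ) = width φ := by
  induction l with
  | nil => rfl
  | cons x l ih => exact ih

theorem realize_conjAtoms (M : Struct σ) (α : List (FAtom σ)) (ρ : ℕ → M.Δ) :
    M.Realize (conjAtoms α) ρ ↔ ∀ a ∈ α, (fun i => ρ (a.2 i)) ∈ M.interp a.1 := by
  induction α with
  | nil => simp [conjAtoms, Struct.Realize]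
  | cons a α ih =>
    have : M.Realize (conjAtoms (a :: α)) ρ ↔
      ((fun i => ρ (a.2 i)) ∈ M.interp a.1 ∧ M.Realize (conjAtoms α) ρ) := Iff.rfl
    rw [this, ih]; simp

theorem freeVars_conjAtoms (α : List (FAtom σ)) (a : FAtom σ) (ha : a ∈ α) (i) :
    a.2 i ∈ freeVars (conjAtoms α) := by
  induction α with
  | nil => simp at ha
  | cons b α ih =>
    have : freeVars (conjAtoms (b :: α)) =
      (Finset.univ.image b.2) ∪ freeVars (conjAtoms α) := rfl
    rw [this, Finset.mem_union]
    rcases List.mem_cons.1 ha with rfl | h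
    · left; simp
    · right; exact ih h

/-! The tree of lists. -/

/-- the tree on lists, parent = tail -/
def listTree (B : Type) : SimpleGraph (List B) where
  Adj l l' := (∃ b, l' = b :: l) ∨ (∃ b, l = b :: l')
  symm := ⟨fun _ _ h => h.symm⟩
  loopless := ⟨by
    rintro l (⟨b, h⟩ | ⟨b, h⟩) <;> simpa using congrArg List.length h⟩

theorem listTree_isTree (B : Type) : (listTree B).IsTree := by
  have hroot : ∀ l : List B, (listTree B).Reachable l [] := by
    intro l
    induction l with
    | nil => exact SimpleGraph.Reachable.refl _
    | cons b l ih =>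
      exact (SimpleGraph.Adj.reachable (Or.inr ⟨b, rfl⟩)).trans ih
  refine ⟨⟨fun u v => (hroot u).trans (hroot v).symm⟩, ?_⟩
  rw [SimpleGraph.isAcyclic_iff_forall_adj_isBridge]
  have main : ∀ (b : B) (l : List B), (listTree B).IsBridge s(l, b :: l) := by
    intro b l
    rw [SimpleGraph.isBridge_iff]
    intro hr
    have inv : ∀ x y, ((listTree B) \ SimpleGraph.fromEdgeSet {s(l, b :: l)}).Adj x y →
        (b :: l <:+ y → b :: l <:+ x) := by
      intro x y hxy hs
      simp only [SimpleGraph.sdiff_adj, SimpleGraph.fromEdgeSet_adj,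
        Set.mem_singleton_iff] at hxy
      obtain ⟨hadj, hne⟩ := hxy
      rcases hadj with ⟨c, rfl⟩ | ⟨c, rfl⟩
      · rcases List.suffix_cons_iff.1 hs with h | h
        · exfalso
          obtain ⟨rfl, rfl⟩ := List.cons.inj h
          exact hne ⟨rfl, by simp⟩
        · exact h
      · exact hs.trans (List.suffix_cons _ _)
    obtain ⟨p⟩ := hr
    have : ∀ x y, (((listTree B) \ SimpleGraph.fromEdgeSet {s(l, b :: l)}).Walk x y) →
        (b :: l <:+ y → b :: l <:+ x) := by
      intro x y p
      induction p with
      | nil => exact id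
      | cons h p ih => exact fun hs => inv _ _ h (ih hs)
    have h := (this _ _ p List.suffix_rfl).length_le
    simp at h
  intro u v huv
  rcases huv with ⟨b, rfl⟩ | ⟨b, rfl⟩
  · exact main b u
  · rw [Sym2.eq_swap]; exact main b v

/-! The unravelling. -/

section Unravel

/-- bags -/
abbrev Bag (D : Type) (k : ℕ) : Type := {B : Finset D // B.card ≤ k}

variable {D : Type} {k : ℕ}

/-- bag of a node -/
def bag : List (Bag D k) → Finset D
  | [] => ∅
  | B :: _ => B.1

open Classical in
/-- origin of an element at a node -/
noncomputable def orig : List (Bag D k) → D → List (Bag D k)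
  | [], _ => []
  | B :: l, m => if m ∈ bag l then orig l m else B :: l

theorem orig_cons_mem (B : Bag D k) (l : List (Bag D k)) (m : D) (h : m ∈ bag l) :
    orig (B :: l) m = orig l m := by simp [orig, h]

theorem orig_cons_not (B : Bag D k) (l : List (Bag D k)) (m : D) (h : m ∉ bag l) :
    orig (B :: l) m = B :: l := by simp [orig, h]

theorem orig_spec (l : List (Bag D k)) (m : D) (h : m ∈ bag l) :
    m ∈ bag (orig l m) ∧ orig (orig l m) m = orig l m := by
  induction l with
  | nil => simp [bag] at h
  | cons B l ih =>
    by_cases hm : m ∈ bag l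
    · rw [orig_cons_mem _ _ _ hm]; exact ih hm
    · rw [orig_cons_not _ _ _ hm]; exact ⟨h, orig_cons_not _ _ _ hm⟩

variable (D k) in
/-- elements of the unravelling -/
def Elt : Type := {p : List (Bag D k) × D // p.2 ∈ bag p.1 ∧ orig p.1 p.2 = p.1}

/-- projection -/
def Elt.pr (a : Elt D k) : D := a.1.2

/-- origin -/
def Elt.og (a : Elt D k) : List (Bag D k) := a.1.1

/-- elements in the bag of a node -/
def fb (l : List (Bag D k)) : Set (Elt D k) := {a | a.pr ∈ bag l ∧ orig l a.pr = a.og}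

theorem Elt.ext' {a b : Elt D k} (h1 : a.og = b.og) (h2 : a.pr = b.pr) : a = b :=
  Subtype.ext (Prod.ext h1 h2)

/-- element at a node -/
noncomputable def mkElt (l : List (Bag D k)) (m : D) (h : m ∈ bag l) : Elt D k :=
  ⟨(orig l m, m), orig_spec l m h⟩

theorem mkElt_mem (l : List (Bag D k)) (m : D) (h : m ∈ bag l) : mkElt l m h ∈ fb l :=
  ⟨h, rfl⟩

theorem pr_inj {l : List (Bag D k)} {a b : Elt D k} (ha : a ∈ fb l) (hb : b ∈ fb l)
    (h : a.pr = b.pr) : a = b :=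
  Elt.ext' (by rw [← ha.2, ← hb.2, h]) h

theorem og_mem (a : Elt D k) : a ∈ fb a.og := a.2

theorem fb_cons {l : List (Bag D k)} {a : Elt D k} (ha : a ∈ fb l) (B : Bag D k)
    (hB : a.pr ∈ B.1) : a ∈ fb (B :: l) :=
  ⟨hB, by rw [orig_cons_mem _ _ _ ha.1]; exact ha.2⟩

theorem fb_cases {l : List (Bag D k)} {B : Bag D k} {a : Elt D k} (ha : a ∈ fb (B :: l)) :
    a ∈ fb l ∨ a.og = B :: l := by
  by_cases h : a.pr ∈ bag l
  · left; exact ⟨h, by rw [← ha.2, orig_cons_mem _ _ _ h]⟩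
  · right; rw [← ha.2, orig_cons_not _ _ _ h]

theorem og_suffix {l : List (Bag D k)} {a : Elt D k} (ha : a ∈ fb l) : a.og <:+ l := by
  induction l with
  | nil => exact absurd ha.1 (by simp [bag])
  | cons B l ih =>
    rcases fb_cases ha with h | h
    · exact (ih h).trans (List.suffix_cons _ _)
    · rw [h]

theorem fb_suffix {l s : List (Bag D k)} {a : Elt D k} (ha : a ∈ fb l) (hs : s <:+ l)
    (hlen : a.og.length ≤ s.length) : a ∈ fb s := by
  induction l with
  | nil => exact absurd ha.1 (by simp [bag])
  | cons B l ih =>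
    rcases List.suffix_cons_iff.1 hs with h | h
    · rw [h]; exact ha
    · rcases fb_cases ha with h' | h'
      · exact ih h' h
      · have := h.length_le
        rw [h'] at hlen
        simp at hlen
        omega

theorem helly (X : Finset ℕ) (ρ : ℕ → Elt D k)
    (h : ∀ v ∈ X, ∀ w ∈ X, v ≠ w → ∃ l, ρ v ∈ fb l ∧ ρ w ∈ fb l) :
    ∃ l, ∀ v ∈ X, ρ v ∈ fb l := by
  rcases X.eq_empty_or_nonempty with rfl | hX
  · exact ⟨[], by simp⟩
  obtain ⟨a, haX, hmax⟩ := X.exists_max_image (fun v => (ρ v).og.length) hX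
  refine ⟨(ρ a).og, fun v hv => ?_⟩
  by_cases hva : v = a
  · subst hva; exact og_mem _
  obtain ⟨l, h1, h2⟩ := h v hv a haX hva
  exact fb_suffix h1 (og_suffix h2) (hmax v hv)

theorem fb_encard (l : List (Bag D k)) : (fb l).encard ≤ k := by
  have h1 : (fb l).encard = (Elt.pr '' fb l).encard :=
    (Set.InjOn.encard_image fun a ha b hb h => pr_inj ha hb h).symm
  have h2 : Elt.pr '' fb l ⊆ (bag l : Set D) := by
    rintro _ ⟨a, ha, rfl⟩; exact ha.1
  rw [h1]
  refine (Set.encard_le_encard h2).trans ?_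
  rw [Set.encard_coe_eq_coe_finsetCard]
  cases l with
  | nil => simp [bag]
  | cons B l => exact_mod_cast B.2

theorem fb_connected (a : Elt D k) :
    ((listTree (Bag D k)).induce {l | a ∈ fb l}).Connected := by
  have key : ∀ l (hl : a ∈ fb l), ((listTree (Bag D k)).induce {l | a ∈ fb l}).Reachable
      ⟨l, hl⟩ ⟨a.og, og_mem a⟩ := by
    intro l
    induction l with
    | nil => intro hl; exact absurd hl.1 (by simp [bag])
    | cons B l ih =>
      intro hl
      rcases fb_cases hl with h | h
      · refine SimpleGraph.Reachable.trans (SimpleGraph.Adj.reachable ?_) (ih h)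
        exact Or.inr ⟨B, rfl⟩
      · have : (⟨B :: l, hl⟩ : {l | a ∈ fb l}) = ⟨a.og, og_mem a⟩ := Subtype.ext h.symm
        rw [this]
  haveI : Nonempty {l | a ∈ fb l} := ⟨⟨a.og, og_mem a⟩⟩
  exact ⟨fun u v => (key u.1 u.2).trans (key v.1 v.2).symm⟩

theorem elt_nonempty (d : D) (hk : 1 ≤ k) : Nonempty (Elt D k) :=
  ⟨mkElt [⟨{d}, by simpa using hk⟩] d (by simp [bag])⟩

end Unravel

/-- the unravelled structure -/
abbrev unr (M : Struct σ) (k : ℕ) (hk : 1 ≤ k) : Struct σ where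
  Δ := Elt M.Δ k
  nonempty := M.nonempty.elim fun d => elt_nonempty d hk
  interp := fun r => {t | (∃ l, Set.range t ⊆ fb l) ∧ (fun i => (t i).pr) ∈ M.interp r}

theorem core (M : Struct σ) (k : ℕ) (hk : 1 ≤ k) (xs ys zs : List ℕ) (α : List (FAtom σ))
    (φ : Fml σ) (hα : CliqueFormula {v | v ∈ xs ∨ v ∈ ys} zs α)
    (hφ : freeVars φ ⊆ xs.toFinset ∪ ys.toFinset)
    (hcard : (freeVars (Fml.and (conjAtoms α) φ)).card ≤ k)
    (ih : ∀ (ρ : ℕ → Elt M.Δ k) l, (∀ v ∈ freeVars φ, ρ v ∈ fb l) →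
      ((unr M k hk).Realize φ ρ ↔ M.Realize φ (fun v => (ρ v).pr)))
    (ρ : ℕ → Elt M.Δ k) (l : List (Bag M.Δ k))
    (hρ : ∀ v ∈ freeVars (exs (ys ++ zs) (Fml.and (conjAtoms α) φ)), ρ v ∈ fb l) :
    (unr M k hk).Realize (exs (ys ++ zs) (Fml.and (conjAtoms α) φ)) ρ ↔
      M.Realize (exs (ys ++ zs) (Fml.and (conjAtoms α) φ)) (fun v => (ρ v).pr) := by
  classical
  rw [realize_exs, realize_exs]
  constructor
  · rintro ⟨τ, h1, h2, h3⟩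
    refine ⟨fun v => Elt.pr (τ v), fun v hv => by simp only [h1 v hv], ?_, ?_⟩
    · rw [realize_conjAtoms] at h2 ⊢
      exact fun a ha => (h2 a ha).2
    · rw [realize_conjAtoms] at h2
      obtain ⟨l', hl'⟩ := helly (freeVars φ) τ (by
        intro v hv w hw hvw
        have hv' := hφ hv
        have hw' := hφ hw
        simp only [Finset.mem_union, List.mem_toFinset] at hv' hw'
        obtain ⟨a, ha, ⟨i, rfl⟩, ⟨j, rfl⟩⟩ := hα.1 v hv' w hw' hvw
        obtain ⟨l', hl'⟩ := (h2 a ha).1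
        exact ⟨l', hl' ⟨i, rfl⟩, hl' ⟨j, rfl⟩⟩)
      exact (ih τ l' hl').1 h3
  · rintro ⟨τ, h1, h2⟩
    set U := freeVars (Fml.and (conjAtoms α) φ) with hU
    let B : Bag M.Δ k := ⟨U.image τ, Finset.card_image_le.trans hcard⟩
    have hB : ∀ v ∈ U, τ v ∈ bag (B :: l) := fun v hv => Finset.mem_image_of_mem τ hv
    let ρ' : ℕ → Elt M.Δ k := fun v =>
      if v ∈ ys ++ zs then (if hv : v ∈ U then mkElt (B :: l) (τ v) (hB v hv) else ρ v) else ρ v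
    have hpr : ∀ v ∈ U, (ρ' v).pr = τ v := by
      intro v hv
      by_cases hy : v ∈ ys ++ zs
      · simp only [ρ', if_pos hy, dif_pos hv]; rfl
      · simp only [ρ', if_neg hy]; exact (h1 v hy).symm
    have hmem : ∀ v ∈ U, ρ' v ∈ fb (B :: l) := by
      intro v hv
      by_cases hy : v ∈ ys ++ zs
      · simp only [ρ', if_pos hy, dif_pos hv]; exact mkElt_mem _ _ _
      · simp only [ρ', if_neg hy]
        refine fb_cons (hρ v ((freeVars_exs _ _ _).2 ⟨hv, hy⟩)) B ?_
        have : (ρ v).pr = τ v := (h1 v hy).symm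
        rw [this]; exact hB v hv
    have h2' := (realize_congr M _ τ (fun v => (ρ' v).pr) (fun v hv => (hpr v hv).symm)).1 h2
    refine ⟨ρ', fun v hv => by simp only [ρ', if_neg hv], ?_, ?_⟩
    · rw [realize_conjAtoms]
      intro a ha
      refine ⟨⟨B :: l, ?_⟩, (realize_conjAtoms M α _).1 h2'.1 a ha⟩
      rintro _ ⟨i, rfl⟩
      exact hmem _ (Finset.mem_union_left _ (freeVars_conjAtoms α a ha i))
    · exact (ih ρ' (B :: l) fun v hv => hmem v (Finset.mem_union_right _ hv)).2 h2'.2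

theorem realize_unr (M : Struct σ) (k : ℕ) (hk : 1 ≤ k) (φ : Fml σ) (hφ : InCGF φ) :
    width φ ≤ k → ∀ (ρ : ℕ → Elt M.Δ k) l, (∀ v ∈ freeVars φ, ρ v ∈ fb l) →
      ((unr M k hk).Realize φ ρ ↔ M.Realize φ (fun v => (ρ v).pr)) := by
  induction hφ with
  | atom r args =>
    intro _ ρ l h
    constructor
    · exact fun H => H.2
    · refine fun H => ⟨⟨l, ?_⟩, H⟩
      rintro _ ⟨i, rfl⟩
      exact h _ (by simp [freeVars])
  | eq v w =>
    intro _ ρ l h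
    constructor
    · exact fun H => congrArg Elt.pr H
    · exact fun H => pr_inj (h v (by simp [freeVars])) (h w (by simp [freeVars])) H
  | not _ ih => intro hw ρ l h; simp only [Struct.Realize]; rw [ih hw ρ l h]
  | and _ _ ih1 ih2 =>
    intro hw ρ l h; simp only [Struct.Realize]
    simp only [width, max_le_iff] at hw
    rw [ih1 hw.1.1 ρ l (fun v hv => h v (by simp [freeVars, hv])),
      ih2 hw.1.2 ρ l (fun v hv => h v (by simp [freeVars, hv]))]
  | or _ _ ih1 ih2 =>
    intro hw ρ l h; simp only [Struct.Realize]
    simp only [width, max_le_iff] at hw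
    rw [ih1 hw.1.1 ρ l (fun v hv => h v (by simp [freeVars, hv])),
      ih2 hw.1.2 ρ l (fun v hv => h v (by simp [freeVars, hv]))]
  | imp _ _ ih1 ih2 =>
    intro hw ρ l h; simp only [Struct.Realize]
    simp only [width, max_le_iff] at hw
    rw [ih1 hw.1.1 ρ l (fun v hv => h v (by simp [freeVars, hv])),
      ih2 hw.1.2 ρ l (fun v hv => h v (by simp [freeVars, hv]))]
  | exG xs ys zs α φ _ hα _ hfv ih =>
    intro hw ρ l h
    rw [width_exs] at hw
    simp only [width, max_le_iff] at hw
    exact core M k hk xs ys zs α φ hα hfv hw.2 (ih hw.1.2) ρ l h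
  | allG xs ys zs α φ _ hα _ hfv ih =>
    intro hw ρ l h
    rw [width_alls] at hw
    simp only [width, max_le_iff] at hw
    have hc := core M k hk xs ys zs α (.not φ) hα hfv hw.2
      (fun ρ l hl => not_congr (ih hw.1.2 ρ l hl)) ρ l
      (fun v hv => h v ((freeVars_alls _ _ _).2 ((freeVars_exs (.and (conjAtoms α) (.not φ)) _ _).1 hv)))
    have dual : ∀ (N : Struct σ) (τ : ℕ → N.Δ),
        N.Realize (alls (ys ++ zs) (.imp (conjAtoms α) φ)) τ ↔
        ¬ N.Realize (exs (ys ++ zs) (.and (conjAtoms α) (.not φ))) τ := by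
      intro N τ
      rw [realize_alls, realize_exs]
      simp only [Struct.Realize]
      push Not
      rfl
    rw [dual, dual, not_congr hc]

/-- Generalized tree model property of the clique guarded fragment: every satisfiable
CGF-sentence `ψ` has a countable model of tree width at most `width(ψ) − 1`. -/
theorem cgf_generalized_tree_model_property (ψ : Fml σ)
    (hcgf : InCGF ψ) (hsentence : freeVars ψ = ∅)
    (hsat : ∃ (M : Struct σ) (ρ : ℕ → M.Δ), M.Realize ψ ρ) :
    ∃ M : Struct σ, Countable M.Δ ∧ TreeWidthLE M (width ψ - 1) ∧
      ∃ ρ : ℕ → M.Δ, M.Realize ψ ρ := by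
  obtain ⟨M, hcount, ρ, hρ⟩ := exists_countable_model ψ hsentence hsat
  have hk : 1 ≤ (width ψ - 1) + 1 := by omega
  let k := (width ψ - 1) + 1
  refine ⟨unr M k hk, ?_, ⟨List (Bag M.Δ k), listTree _, fb, listTree_isTree _, ?_, ?_, ?_⟩, ?_⟩
  · have : Countable (List (Bag M.Δ k) × M.Δ) := inferInstance
    exact (Subtype.val_injective : Function.Injective
      (Subtype.val : Elt M.Δ k → List (Bag M.Δ k) × M.Δ)).countable
  · intro v
    exact (fb_encard v).trans (by simp [k])
  · exact fun r t ht => ht.1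
  · exact fun a => fb_connected a
  · obtain ⟨d⟩ := (unr M k hk).nonempty
    refine ⟨fun _ => d, ?_⟩
    refine (realize_unr M k hk ψ hcgf (by omega) (fun _ => d) [] (by simp [hsentence])).2 ?_
    exact (realize_congr M ψ _ ρ (by simp [hsentence])).2 hρ

end Stmt19
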